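/- Consider the discrete-time linear system with zero initial state x0 = 0, let P(t) = Σ_{k=0}^{N} α_k t^k be a non-zero polynomial over F satisfying C·P(A)·A^τ·B = 0 for all natural numbers τ, and let G(z) = Σ_{k=1}^{N} (Σ_{j=k}^{N} α_j · C·A^{j−k}·B) z^{k−1} + P(z)·D. Then the map sending a causal input sequence u : ℤ → F^m to the corresponding output sequence y : ℤ → F^l of the system is injective if and only if G has full column rank over the polynomial ring F[z]. -/

import Mathlib

open Matrix Finset Polynomial

/-- State sequence of the discrete-time linear system:
`x[0] = x0`, `x[n+1] = A·x[n] + B·u[n]`. -/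
def stateSeq {F : Type*} [Field F] {N m : ℕ} (A : Matrix (Fin N) (Fin N) F)
    (B : Matrix (Fin N) (Fin m) F) (x0 : Fin N → F) (u : ℤ → Fin m → F) :
    ℕ → Fin N → F
  | 0 => x0
  | n + 1 => A.mulVec (stateSeq A B x0 u n) + B.mulVec (u n)

/-- Output sequence of the system: `y[n] = C·x[n] + D·u[n]` for `n ≥ 0`,
and `y[n] = 0` for `n < 0`. -/
def outSeq {F : Type*} [Field F] {N m l : ℕ} (A : Matrix (Fin N) (Fin N) F)
    (B : Matrix (Fin N) (Fin m) F) (C : Matrix (Fin l) (Fin N) F)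
    (D : Matrix (Fin l) (Fin m) F) (x0 : Fin N → F) (u : ℤ → Fin m → F)
    (n : ℤ) : Fin l → F :=
  if n < 0 then 0 else C.mulVec (stateSeq A B x0 u n.toNat) + D.mulVec (u n)

open scoped PowerSeries

section IndependenceUnderRingHom

theorem linearIndependent_ringHom_comp_iff {R S ι ι' : Type*} [Finite ι'] [CommRing R] [CommRing S]
    [IsDomain S] (φ : R →+* S) (hφ : Function.Injective φ) {v : ι → ι' → R} :
    LinearIndependent S (fun i j => φ (v i j)) ↔ LinearIndependent R v := by
  let : Algebra R S := φ.toAlgebra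
  have : FaithfulSMul R S := (faithfulSMul_iff_algebraMap_injective R S).mpr hφ
  exact linearIndependent_algebraMap_comp_iff (R := R) (S := S) (v := v)

theorem linearIndependent_mul_left_iff {K ι ι' : Type*} [CommRing K] [IsDomain K] {c : K}
    (hc : c ≠ 0) {v : ι → ι' → K} :
    LinearIndependent K (fun i j => c * v i j) ↔ LinearIndependent K v := by
  have hinj : Function.Injective (LinearMap.lsmul K (ι' → K) c) := by
    intro a b hab
    funext j
    exact mul_left_cancel₀ hc (congrFun hab j)
  exact (LinearMap.lsmul K (ι' → K) c).linearIndependent_iff (LinearMap.ker_eq_bot.mpr hinj)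

end IndependenceUnderRingHom

section EvalAtInverse

variable {F : Type*} [Field F]

/-- The ring homomorphism `F[z] → F⸨w⸩` sending `z` to `w⁻¹`. -/
noncomputable def polyToLaurentInv (F : Type*) [Field F] : F[X] →+* LaurentSeries F :=
  (Polynomial.aeval (HahnSeries.ofPowerSeries ℤ F (PowerSeries.X : F⟦X⟧))⁻¹).toRingHom

theorem coe_X_ne_zero : (HahnSeries.ofPowerSeries ℤ F (PowerSeries.X : F⟦X⟧)) ≠ 0 :=
  (map_ne_zero_iff _ HahnSeries.ofPowerSeries_injective).mpr PowerSeries.X_ne_zero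

theorem polyToLaurentInv_X :
    polyToLaurentInv F X = (HahnSeries.ofPowerSeries ℤ F (PowerSeries.X : F⟦X⟧))⁻¹ :=
  Polynomial.aeval_X _

theorem polyToLaurentInv_C (a : F) :
    polyToLaurentInv F (Polynomial.C a) = HahnSeries.ofPowerSeries ℤ F (PowerSeries.C a) := by
  refine (Polynomial.aeval_C _ a).trans ?_
  rfl

theorem polyToLaurentInv_injective : Function.Injective (polyToLaurentInv F) := by
  have hX : Transcendental F (HahnSeries.ofPowerSeries ℤ F (PowerSeries.X : F⟦X⟧)) := by
    rw [transcendental_iff_injective]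
    have hcoe : ∀ p : F[X], Polynomial.aeval
        (HahnSeries.ofPowerSeries ℤ F (PowerSeries.X : F⟦X⟧)) p
          = HahnSeries.ofPowerSeries ℤ F (p : F⟦X⟧) := by
      intro p
      induction p using Polynomial.induction_on' with
      | add p q hp hq => rw [map_add, hp, hq, Polynomial.coe_add, map_add]
      | monomial n a =>
        rw [Polynomial.aeval_monomial, ← Polynomial.C_mul_X_pow_eq_monomial]
        rw [Polynomial.coe_mul, Polynomial.coe_pow, Polynomial.coe_C, Polynomial.coe_X, map_mul,
          map_pow]
        rfl
    intro p q hpq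
    rw [hcoe, hcoe] at hpq
    exact Polynomial.coe_injective F (HahnSeries.ofPowerSeries_injective hpq)
  have hX' : Transcendental F (HahnSeries.ofPowerSeries ℤ F (PowerSeries.X : F⟦X⟧))⁻¹ :=
    fun h => hX (IsAlgebraic.inv_iff.mp h)
  exact transcendental_iff_injective.mp hX'

end EvalAtInverse

section AnnihilatedSeries

variable {F : Type*} [Field F]

/-- If the recurrence with coefficients `α` annihilates `s`, then `P(w⁻¹)` times
`Σ s k w ^ (k + 1)` has no terms of positive order, and is an explicit polynomial in `w⁻¹`. -/
theorem polyToLaurentInv_mul_of_recurrence (N : ℕ) (α : ℕ → F) (s : ℕ → F)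
    (hs : ∀ τ, ∑ k ∈ Finset.range (N + 1), α k * s (k + τ) = 0) :
    polyToLaurentInv F (∑ k ∈ Finset.range (N + 1), Polynomial.C (α k) * X ^ k) *
        HahnSeries.ofPowerSeries ℤ F (PowerSeries.X * PowerSeries.mk s) =
      polyToLaurentInv F (∑ k ∈ Finset.Icc 1 N,
        X ^ (k - 1) * Polynomial.C (∑ j ∈ Finset.Icc k N, α j * s (j - k))) := by
  have hw := coe_X_ne_zero (F := F)
  have hz := polyToLaurentInv_X (F := F)
  have hshift : ∀ k, HahnSeries.ofPowerSeries ℤ F (PowerSeries.mk s) =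
      HahnSeries.ofPowerSeries ℤ F PowerSeries.X ^ k *
        HahnSeries.ofPowerSeries ℤ F (PowerSeries.mk fun i => s (i + k)) +
      ∑ i ∈ Finset.range k, HahnSeries.ofPowerSeries ℤ F (PowerSeries.C (s i)) *
        HahnSeries.ofPowerSeries ℤ F PowerSeries.X ^ i := by
    intro k
    rw [← map_pow, ← map_mul]
    conv_lhs => rw [PowerSeries.eq_X_pow_mul_shift_add_trunc k (PowerSeries.mk s)]
    rw [map_add]
    congr 1
    · simp
    · simp only [← map_pow, ← map_mul, ← map_sum]
      congr 1
      ext n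
      simp [PowerSeries.coeff_trunc, PowerSeries.coeff_X_pow, Finset.sum_ite_eq]
  have htail : ∑ k ∈ Finset.range (N + 1), HahnSeries.ofPowerSeries ℤ F (PowerSeries.C (α k)) *
      HahnSeries.ofPowerSeries ℤ F (PowerSeries.mk fun i => s (i + k)) = 0 := by
    simp only [← map_mul, ← map_sum]
    rw [map_eq_zero_iff _ HahnSeries.ofPowerSeries_injective]
    ext τ
    simpa [add_comm] using hs τ
  simp only [map_sum, map_mul, map_pow, polyToLaurentInv_C, hz, Finset.sum_mul, Finset.mul_sum]
  generalize HahnSeries.ofPowerSeries ℤ F PowerSeries.X = w at *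
  have hvw : w⁻¹ * w = 1 := inv_mul_cancel₀ hw
  generalize w⁻¹ = v at *
  have hpow : ∀ k : ℕ, v ^ k * w ^ k = 1 := fun k => by rw [← mul_pow, hvw, one_pow]
  have hterm : ∀ k, HahnSeries.ofPowerSeries ℤ F (PowerSeries.C (α k)) * v ^ k *
      (w * HahnSeries.ofPowerSeries ℤ F (PowerSeries.mk s)) =
      w * (HahnSeries.ofPowerSeries ℤ F (PowerSeries.C (α k)) *
        HahnSeries.ofPowerSeries ℤ F (PowerSeries.mk fun i => s (i + k))) +
      ∑ i ∈ Finset.Icc 1 k, v ^ (i - 1) *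
        (HahnSeries.ofPowerSeries ℤ F (PowerSeries.C (α k)) *
          HahnSeries.ofPowerSeries ℤ F (PowerSeries.C (s (k - i)))) := by
    intro k
    rw [hshift k, mul_add, mul_add]
    congr 1
    · linear_combination (HahnSeries.ofPowerSeries ℤ F (PowerSeries.C (α k)) * w *
        HahnSeries.ofPowerSeries ℤ F (PowerSeries.mk fun i => s (i + k))) * hpow k
    · rw [← Finset.sum_range_reflect, Finset.mul_sum, Finset.mul_sum,
        Finset.range_eq_Ico, Finset.sum_Ico_eq_sum_range, ← Finset.Ico_add_one_right_eq_Icc,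
        Finset.sum_Ico_eq_sum_range]
      refine Finset.sum_congr rfl fun i hi => ?_
      have hik : i < k := by simpa using hi
      obtain ⟨d, rfl⟩ := Nat.exists_eq_add_of_lt hik
      have h1 : i + d + 1 - 1 - (0 + i) = d := by omega
      have h2 : i + d + 1 - (1 + i) = d := by omega
      have h3 : 1 + i - 1 = i := by omega
      rw [h1, h2, h3]
      linear_combination (v ^ i * HahnSeries.ofPowerSeries ℤ F (PowerSeries.C (α (i + d + 1))) *
        HahnSeries.ofPowerSeries ℤ F (PowerSeries.C (s d))) * hpow (d + 1)
  rw [Finset.sum_congr rfl fun k _ => hterm k, Finset.sum_add_distrib, ← Finset.mul_sum, htail,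
    mul_zero, zero_add]
  refine Finset.sum_comm' fun k i => ?_
  simp only [Finset.mem_range, Finset.mem_Icc]
  omega

end AnnihilatedSeries

section TransferMatrix

variable {F : Type*} [Field F] {N m l : ℕ}

/-- The transfer matrix `D + Σ C A ^ k B w ^ (k + 1)`, as a power series in `w = z⁻¹`. -/
noncomputable def transferMatrix (A : Matrix (Fin N) (Fin N) F) (B : Matrix (Fin N) (Fin m) F)
    (C : Matrix (Fin l) (Fin N) F) (D : Matrix (Fin l) (Fin m) F) :
    Matrix (Fin l) (Fin m) F⟦X⟧ :=
  fun i j => PowerSeries.C (D i j) + PowerSeries.X * PowerSeries.mk fun k => (C * A ^ k * B) i j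

theorem stateSeq_zero_succ (A : Matrix (Fin N) (Fin N) F) (B : Matrix (Fin N) (Fin m) F)
    (u : ℤ → Fin m → F) (n : ℕ) :
    stateSeq A B 0 u (n + 1) =
      ∑ p ∈ Finset.HasAntidiagonal.antidiagonal n, (A ^ p.1 * B).mulVec (u p.2) := by
  induction n with
  | zero => simp [stateSeq]
  | succ n ih =>
    rw [stateSeq, ih, Finset.Nat.sum_antidiagonal_succ, Matrix.mulVec_sum, add_comm]
    simp [pow_succ', Matrix.mul_assoc]

theorem coeff_transferMatrix_mulVec (A : Matrix (Fin N) (Fin N) F)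
    (B : Matrix (Fin N) (Fin m) F) (C : Matrix (Fin l) (Fin N) F) (D : Matrix (Fin l) (Fin m) F)
    (u : ℤ → Fin m → F) (i : Fin l) (n : ℕ) :
    PowerSeries.coeff n ((transferMatrix A B C D).mulVec
      (fun j => PowerSeries.mk fun k : ℕ => u k j) i) = outSeq A B C D 0 u n i := by
  have hout : outSeq A B C D 0 u n = C.mulVec (stateSeq A B 0 u n) + D.mulVec (u n) := by
    simp [outSeq]
  rw [hout]
  simp only [Matrix.mulVec, dotProduct, transferMatrix, map_sum, add_mul, map_add, Pi.add_apply,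
    Finset.sum_add_distrib]
  rw [add_comm]
  congr 1
  · cases n with
    | zero => simp [stateSeq, mul_assoc]
    | succ n =>
      have h := congrFun (congrArg C.mulVec (stateSeq_zero_succ A B u n)) i
      rw [Matrix.mulVec_sum, Finset.sum_apply] at h
      refine Eq.trans ?_ h.symm
      simp only [mul_assoc, PowerSeries.coeff_succ_X_mul]
      simp only [PowerSeries.coeff_mul, PowerSeries.coeff_mk, Matrix.mulVec_mulVec]
      rw [Finset.sum_comm]
      simp [Matrix.mulVec, dotProduct, Matrix.mul_assoc]
  · simp

theorem injective_outSeq_iff (A : Matrix (Fin N) (Fin N) F)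
    (B : Matrix (Fin N) (Fin m) F) (C : Matrix (Fin l) (Fin N) F)
    (D : Matrix (Fin l) (Fin m) F) :
    (∀ u v : ℤ → Fin m → F, (∀ n : ℤ, n < 0 → u n = 0) → (∀ n : ℤ, n < 0 → v n = 0) →
        (∀ n : ℤ, outSeq A B C D 0 u n = outSeq A B C D 0 v n) → u = v) ↔
      Function.Injective (transferMatrix A B C D).mulVec := by
  constructor
  · intro h U V hUV
    let toSeq (W : Fin m → F⟦X⟧) : ℤ → Fin m → F := fun n j =>
      if n < 0 then 0 else PowerSeries.coeff n.toNat (W j)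
    have hto : ∀ W, (fun j => PowerSeries.mk fun k : ℕ => toSeq W k j) = W := by
      intro W
      ext j n
      simp [toSeq]
    have hneg : ∀ W n, n < 0 → toSeq W n = 0 := by
      intro W n hn
      funext j
      simp [toSeq, hn]
    have heq : toSeq U = toSeq V := by
      refine h _ _ (hneg U) (hneg V) fun n => ?_
      rcases lt_or_ge n 0 with hn | hn
      · simp [outSeq, hn]
      · lift n to ℕ using hn
        funext i
        rw [← coeff_transferMatrix_mulVec, ← coeff_transferMatrix_mulVec, hto, hto, hUV]
    rw [← hto U, ← hto V, heq]
  · intro h u v hu hv huv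
    have hUV : (fun j => PowerSeries.mk fun k : ℕ => u k j) =
        fun j => PowerSeries.mk fun k : ℕ => v k j := by
      apply h
      ext i n
      rw [coeff_transferMatrix_mulVec, coeff_transferMatrix_mulVec, huv]
    funext n j
    rcases lt_or_ge n 0 with hn | hn
    · rw [hu n hn, hv n hn]
    · lift n to ℕ using hn
      simpa using congrArg (PowerSeries.coeff n) (congrFun hUV j)

end TransferMatrix

/-- with zero initial state and a non-zero polynomial
`P(t) = Σ_{k=0}^{N} α_k t^k` satisfying `C·P(A)·A^τ·B = 0` for all `τ`, the map
sending a causal input `u` to the corresponding output `y` is injective iff the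
polynomial matrix `G(z) = Σ_{k=1}^{N} (Σ_{j=k}^{N} α_j·C·A^{j−k}·B) z^{k−1} + P(z)·D`
has full column rank over `F[z]`. -/
theorem stmt10 {F : Type*} [Field F] {N m l : ℕ} (A : Matrix (Fin N) (Fin N) F)
    (B : Matrix (Fin N) (Fin m) F) (C : Matrix (Fin l) (Fin N) F)
    (D : Matrix (Fin l) (Fin m) F) (α : ℕ → F)
    (hα : ∃ k ≤ N, α k ≠ 0)
    (hP : ∀ τ : ℕ, C * (∑ k ∈ Finset.range (N + 1), α k • A ^ k) * A ^ τ * B = 0) :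
    let G : Matrix (Fin l) (Fin m) (Polynomial F) :=
      (∑ k ∈ Finset.Icc 1 N, (Polynomial.X : Polynomial F) ^ (k - 1) •
          ((∑ j ∈ Finset.Icc k N, α j • (C * A ^ (j - k) * B)).map Polynomial.C))
        + (∑ k ∈ Finset.range (N + 1), Polynomial.C (α k) * Polynomial.X ^ k) •
            (D.map Polynomial.C)
    ((∀ u v : ℤ → Fin m → F, (∀ n : ℤ, n < 0 → u n = 0) → (∀ n : ℤ, n < 0 → v n = 0) →
        (∀ n : ℤ, outSeq A B C D 0 u n = outSeq A B C D 0 v n) → u = v) ↔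
      LinearIndependent (Polynomial F) (fun j : Fin m => G.transpose j)) := by
  intro G
  set P : F[X] := ∑ k ∈ Finset.range (N + 1), Polynomial.C (α k) * X ^ k with hPdef
  have hP0 : P ≠ 0 := by
    obtain ⟨k, hkN, hk⟩ := hα
    intro h0
    apply hk
    have := congrArg (fun p => Polynomial.coeff p k) h0
    simpa [hPdef, Polynomial.finsetSum_coeff, Polynomial.coeff_C_mul, Polynomial.coeff_X_pow,
      Nat.lt_succ_iff.mpr hkN] using this
  have hφP : polyToLaurentInv F P ≠ 0 :=
    (map_ne_zero_iff _ polyToLaurentInv_injective).mpr hP0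
  have hG : ∀ i j, polyToLaurentInv F (G i j) =
      polyToLaurentInv F P * HahnSeries.ofPowerSeries ℤ F (transferMatrix A B C D i j) := by
    intro i j
    have hs : ∀ τ, ∑ k ∈ Finset.range (N + 1), α k * (C * A ^ (k + τ) * B) i j = 0 := by
      intro τ
      have h := congrFun (congrFun (hP τ) i) j
      simpa [Matrix.mul_sum, Matrix.sum_mul, Matrix.sum_apply, Matrix.mul_assoc, pow_add]
        using h
    have hrec := polyToLaurentInv_mul_of_recurrence N α (fun k => (C * A ^ k * B) i j) hs
    rw [transferMatrix, map_add, mul_add, hrec, ← polyToLaurentInv_C, ← map_mul, ← map_add]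
    congr 1
    simp [G, P, Matrix.sum_apply, add_comm]
  rw [injective_outSeq_iff, Matrix.mulVec_injective_iff,
    ← linearIndependent_ringHom_comp_iff (HahnSeries.ofPowerSeries ℤ F)
      HahnSeries.ofPowerSeries_injective,
    ← linearIndependent_ringHom_comp_iff (polyToLaurentInv F) polyToLaurentInv_injective,
    ← linearIndependent_mul_left_iff hφP]
  simp only [Matrix.transpose_apply, hG, Matrix.col_apply]
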